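/- arXiv:2407.20953 — 2 statements merged into one kernel-verified Lean document; each statement's English description precedes it below -/
import Mathlib

section
/- Lemma 1.3(a), second case: Let B ∈ φ(V_D) and i ∈ Z/(D+1) with {i} ∈ B and g_i(B) ≥ 2. Let I₂ ∈ B be such that i ∈ I₂, I₂ ≠ {i}, and I₂ ⊆ J for every J ∈ B with i ∈ J and J ≠ {i}. Then there exist H, H' ∈ ℐ¹ with H ∩ H' = ∅ and H ∪ H' = I₂ − {i}, such that H ∉ B, H' ∉ B, and (B ∪ {H, H'}) − {{i}, I₂} ∈ φ(V_D). -/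
open scoped BigOperators

/-- `W D` : functions `Z/(D+1) → F₂`. -/
abbrev Wsp (D : ℕ) : Type := ZMod (D + 1) → ZMod 2

/-- The all-ones function. -/
def allOnes (D : ℕ) : Wsp D := fun _ => 1

/-- `V D = W/span{u}`. -/
abbrev Vsp (D : ℕ) : Type := Wsp D ⧸ Submodule.span (ZMod 2) {allOnes D}

/-- `e i` : image of the standard basis function at `i`. -/
def eV (D : ℕ) (i : ZMod (D + 1)) : Vsp D :=
  Submodule.Quotient.mk (Pi.single i 1)

/-- `e_I = ∑_{s ∈ I} e_s`. -/
def eSet (D : ℕ) (I : Finset (ZMod (D + 1))) : Vsp D := ∑ s ∈ I, eV D s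

/-- A cyclic interval (arc): nonempty proper subset of the form `{i, i+1, …, j}`. -/
def IsInterval (D : ℕ) (I : Finset (ZMod (D + 1))) : Prop :=
  ∃ (i : ZMod (D + 1)) (l : ℕ), 1 ≤ l ∧ l ≤ D ∧
    I = (Finset.range l).image (fun t : ℕ => i + (t : ZMod (D + 1)))

/-- Member of `ℐ¹` : interval of odd cardinality. -/
def OddInterval (D : ℕ) (I : Finset (ZMod (D + 1))) : Prop :=
  IsInterval D I ∧ Odd I.card

/-- `I ≺ I'` : `I ⊊ I'` and `I' − I` is a disjoint union of two intervals. -/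
def Prec (D : ℕ) (I I' : Finset (ZMod (D + 1))) : Prop :=
  I ⊂ I' ∧ ∃ I₁ I₂, IsInterval D I₁ ∧ IsInterval D I₂ ∧ Disjoint I₁ I₂ ∧ I' \ I = I₁ ∪ I₂

/-- `I ♠ I'` : `I ∩ I' = ∅` and `I ∪ I'` is not an interval. -/
def Spade (D : ℕ) (I I' : Finset (ZMod (D + 1))) : Prop :=
  I ∩ I' = ∅ ∧ ¬ IsInterval D (I ∪ I')

/-- `I^ev`. -/
noncomputable def evSet (D : ℕ) (I : Finset (ZMod (D + 1))) : Finset (ZMod (D + 1)) :=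
  @Finset.filter _
    (fun i => ∃ I' I'', OddInterval D I' ∧ OddInterval D I'' ∧ Spade D I' I'' ∧
      I.erase i = I' ∪ I'')
    (Classical.decPred _) I

/-- `B ∈ φ(V_D)` : a finite set of elements of `ℐ¹` satisfying (P0) and (P1). -/
def phi (D : ℕ) (B : Finset (Finset (ZMod (D + 1)))) : Prop :=
  (∀ I ∈ B, OddInterval D I) ∧
  (∀ I ∈ B, ∀ I' ∈ B, I = I' ∨ Spade D I I' ∨ Prec D I I' ∨ Prec D I' I) ∧
  (∀ I ∈ B, ∃ 𝒥 : Finset (Finset (ZMod (D + 1))), 𝒥 ⊆ B ∧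
    (∀ J ∈ 𝒥, Prec D J I) ∧
    (∀ J ∈ 𝒥, ∀ J' ∈ 𝒥, J ≠ J' → Disjoint J J') ∧
    evSet D I ⊆ 𝒥.biUnion id)

/-- `⟨B⟩` : the F₂-span of `{e_I : I ∈ B}`. -/
def spanB (D : ℕ) (B : Finset (Finset (ZMod (D + 1)))) : Submodule (ZMod 2) (Vsp D) :=
  Submodule.span (ZMod 2) (eSet D '' ↑B)

/-- `g_i(B) = |{I ∈ B : i ∈ I}|`. -/
def gB (D : ℕ) (B : Finset (Finset (ZMod (D + 1)))) (i : ZMod (D + 1)) : ℕ :=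
  (B.filter (fun I => i ∈ I)).card

/-- `ε(B) = ∑_i (g_i(B)(g_i(B)+1)/2 mod 2) e_i`. -/
def epsB (D : ℕ) (B : Finset (Finset (ZMod (D + 1)))) : Vsp D :=
  ∑ i : ZMod (D + 1), ((gB D B i * (gB D B i + 1) / 2 : ℕ) : ZMod 2) • eV D i

/-- The partial order `B' ≤ B` on `φ(V_D)`. -/
def leφ (D : ℕ) (B' B : Finset (Finset (ZMod (D + 1)))) : Prop :=
  ∃ (k : ℕ) (c : ℕ → Finset (Finset (ZMod (D + 1)))),
    c 0 = B' ∧ c k = B ∧ (∀ s ≤ k, phi D (c s)) ∧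
    ∀ s < k, epsB D (c s) ∈ spanB D (c (s + 1))

/-- `B' < B`. -/
def ltφ (D : ℕ) (B' B : Finset (Finset (ZMod (D + 1)))) : Prop :=
  leφ D B' B ∧ B' ≠ B

/-- `1_E ∈ ℂ[V_D]`, the indicator function of `E ⊆ V_D`. -/
noncomputable def ind (D : ℕ) (E : Set (Vsp D)) : Vsp D → ℂ := E.indicator 1

/-- `δ_x ∈ ℂ[V_D]`. -/
noncomputable def delta (D : ℕ) (x : Vsp D) : Vsp D → ℂ := ind D {x}

/-- The symplectic form on `W`. -/
def formW (D : ℕ) (x y : Wsp D) : ZMod 2 :=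
  ∑ i : ZMod (D + 1), (x i * y (i + 1) + x (i + 1) * y i)

/-- The induced symplectic form on `V_D` (well defined since the form kills `u`). -/
noncomputable def formV (D : ℕ) (x y : Vsp D) : ZMod 2 :=
  formW D (Quotient.out x) (Quotient.out y)

/-- The Fourier transform `ℂ[V_D] → ℂ[V_D]`. -/
noncomputable def fourierV (D : ℕ) (f : Vsp D → ℂ) : Vsp D → ℂ :=
  fun y => (2 : ℂ) ^ (-((D / 2 : ℕ) : ℤ)) *
    ∑ᶠ x : Vsp D, (if formV D x y = 0 then (1 : ℂ) else -1) * f x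

/-- The target in `V_D` of the basis vector `e'_ℓ` of `V_{D-2}` under `τ_j`. -/
noncomputable def tauTgt (D j : ℕ) (ℓ : ZMod (D - 2 + 1)) : Vsp D :=
  let L : ℕ := if ℓ.val = 0 then D - 1 else ℓ.val
  if ℓ = ((j - 1 : ℕ) : ZMod (D - 2 + 1)) then
    eV D ((j : ZMod (D + 1)) - 1) + eV D (j : ZMod (D + 1)) + eV D ((j : ZMod (D + 1)) + 1)
  else if L < j - 1 then eV D (L : ZMod (D + 1))
  else eV D ((L + 2 : ℕ) : ZMod (D + 1))

/-- The linear embedding `τ_j : V_{D-2} → V_D` (well defined independently of the chosen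
representative since the targets sum to `0`). -/
noncomputable def tauMap (D j : ℕ) (x : Vsp (D - 2)) : Vsp D :=
  ∑ i : ZMod (D - 2 + 1), (Quotient.out x) i • tauTgt D j i

/-- The cyclic arc of length `l` starting at `a`. -/
def arc (D : ℕ) (a : ZMod (D + 1)) (l : ℕ) : Finset (ZMod (D + 1)) :=
  (Finset.range l).image (fun t : ℕ => a + (t : ZMod (D + 1)))

/-- Two subsets are disjoint and no element of one is adjacent to an element of the other. -/
def Nonadjacent (D : ℕ) (I J : Finset (ZMod (D + 1))) : Prop :=
  (∀ x ∈ I, x ∉ J ∧ x + 1 ∉ J) ∧ ∀ x ∈ J, x + 1 ∉ I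

theorem Nonadjacent.symm {D : ℕ} {I J : Finset (ZMod (D + 1))} (h : Nonadjacent D I J) :
    Nonadjacent D J I :=
  ⟨fun x hx => ⟨fun hx' => (h.1 x hx').1 hx, h.2 x hx⟩, fun x hx => (h.1 x hx).2⟩

theorem Nonadjacent.mono {D : ℕ} {I J I' J' : Finset (ZMod (D + 1))} (h : Nonadjacent D I J)
    (hI : I' ⊆ I) (hJ : J' ⊆ J) : Nonadjacent D I' J' :=
  ⟨fun x hx => ⟨fun hx' => (h.1 x (hI hx)).1 (hJ hx'), fun hx' => (h.1 x (hI hx)).2 (hJ hx')⟩,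
    fun x hx hx' => h.2 x (hJ hx) (hI hx')⟩

theorem natCast_inj_of_le {D u v : ℕ} (hu : u ≤ D) (hv : v ≤ D)
    (h : (u : ZMod (D + 1)) = v) : u = v := by
  have := congrArg ZMod.val h
  rwa [ZMod.val_natCast_of_lt (by omega), ZMod.val_natCast_of_lt (by omega)] at this

theorem mem_arc {D : ℕ} {a x : ZMod (D + 1)} {l : ℕ} :
    x ∈ arc D a l ↔ ∃ u < l, x = a + (u : ZMod (D + 1)) := by
  simp [arc, eq_comm]

theorem add_mem_arc_add {D : ℕ} (a : ZMod (D + 1)) {s m u : ℕ} (hm : s + m ≤ D + 1)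
    (hu : u ≤ D) :
    a + (u : ZMod (D + 1)) ∈ arc D (a + (s : ZMod (D + 1))) m ↔ s ≤ u ∧ u < s + m := by
  rw [mem_arc]
  constructor
  · rintro ⟨v, hv, h⟩
    rw [add_assoc, add_right_inj, ← Nat.cast_add] at h
    have := natCast_inj_of_le hu (by omega) h
    omega
  · rintro ⟨h₁, h₂⟩
    refine ⟨u - s, by omega, ?_⟩
    rw [add_assoc, ← Nat.cast_add]
    congr 2
    omega

theorem add_mem_arc {D : ℕ} (a : ZMod (D + 1)) {m u : ℕ} (hm : m ≤ D + 1) (hu : u ≤ D) :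
    a + (u : ZMod (D + 1)) ∈ arc D a m ↔ u < m := by
  simpa using add_mem_arc_add a (s := 0) (by omega : 0 + m ≤ D + 1) hu

theorem exists_eq_add (D : ℕ) (a x : ZMod (D + 1)) :
    ∃ u ≤ D, x = a + (u : ZMod (D + 1)) :=
  ⟨(x - a).val, Nat.lt_succ_iff.mp (ZMod.val_lt _), by simp⟩

theorem card_arc {D : ℕ} (a : ZMod (D + 1)) {l : ℕ} (hl : l ≤ D + 1) : (arc D a l).card = l := by
  rw [arc, Finset.card_image_of_injOn, Finset.card_range]
  intro u hu v hv h
  simp only [Finset.coe_range, Set.mem_Iio] at hu hv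
  exact natCast_inj_of_le (by omega) (by omega) (add_left_cancel h)

theorem isInterval_arc {D : ℕ} (a : ZMod (D + 1)) {l : ℕ} (h₁ : 1 ≤ l) (h₂ : l ≤ D) :
    IsInterval D (arc D a l) := ⟨a, l, h₁, h₂, rfl⟩

theorem oddInterval_iff {D : ℕ} {I : Finset (ZMod (D + 1))} :
    OddInterval D I ↔ ∃ a l, Odd l ∧ l ≤ D ∧ I = arc D a l := by
  constructor
  · rintro ⟨⟨a, l, h₁, h₂, rfl⟩, hodd⟩
    refine ⟨a, l, ?_, h₂, rfl⟩
    rwa [← arc, card_arc a (by omega)] at hodd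
  · rintro ⟨a, l, hodd, h₂, rfl⟩
    exact ⟨isInterval_arc a hodd.pos h₂, by rwa [card_arc a (by omega)]⟩

theorem exists_of_arc_subset {D : ℕ} {a b : ZMod (D + 1)} {l m : ℕ} (hm : 1 ≤ m) (hl : l ≤ D)
    (h : arc D b m ⊆ arc D a l) :
    ∃ s : ℕ, s + m ≤ l ∧ b = a + (s : ZMod (D + 1)) := by
  have hb : b ∈ arc D a l := h (mem_arc.2 ⟨0, hm, by simp⟩)
  obtain ⟨s, hs, rfl⟩ := mem_arc.1 hb
  refine ⟨s, ?_, rfl⟩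
  by_contra hlt
  have : a + (l : ZMod (D + 1)) ∈ arc D a l := h (mem_arc.2 ⟨l - s, by omega, by
    rw [add_assoc, ← Nat.cast_add]; congr 2; omega⟩)
  rw [add_mem_arc a (by omega) hl] at this
  omega

theorem arc_append (D : ℕ) (a : ZMod (D + 1)) (l m : ℕ) :
    arc D a l ∪ arc D (a + (l : ZMod (D + 1))) m = arc D a (l + m) := by
  ext x
  simp only [Finset.mem_union, mem_arc]
  constructor
  · rintro (⟨u, hu, rfl⟩ | ⟨u, hu, rfl⟩)
    · exact ⟨u, by omega, rfl⟩
    · exact ⟨l + u, by omega, by push_cast; ring⟩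
  · rintro ⟨u, hu, rfl⟩
    by_cases h : u < l
    · exact Or.inl ⟨u, h, rfl⟩
    · exact Or.inr ⟨u - l, by omega, by rw [Nat.cast_sub (by omega)]; ring⟩

/-- Disjoint arcs, the second of which contains the successor of an element of the first,
form a longer arc. -/
theorem arc_union_of_succ_mem {D : ℕ} {a b x : ZMod (D + 1)} {l m : ℕ}
    (hdisj : arc D a l ∩ arc D b m = ∅) (hx : x ∈ arc D a l) (hx' : x + 1 ∈ arc D b m) :
    arc D a l ∪ arc D b m = arc D a (l + m) := by
  have hd : ∀ y ∈ arc D a l, y ∉ arc D b m := fun y hy hy' => by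
    have := Finset.mem_inter.2 ⟨hy, hy'⟩
    simp [hdisj] at this
  obtain ⟨u, hu, rfl⟩ := mem_arc.1 hx
  have hul : u + 1 = l := by
    by_contra hne
    exact hd _ (mem_arc.2 ⟨u + 1, by omega, by push_cast; ring⟩) hx'
  obtain ⟨v, hv, hv'⟩ := mem_arc.1 hx'
  have hv0 : v = 0 := by
    by_contra hne
    refine hd _ hx (mem_arc.2 ⟨v - 1, by omega, ?_⟩)
    rw [Nat.cast_sub (by omega)]
    linear_combination hv'
  subst hv0 hul
  have hb : b = a + ((u + 1 : ℕ) : ZMod (D + 1)) := by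
    push_cast at hv' ⊢
    linear_combination -hv'
  rw [hb]
  exact arc_append D a (u + 1) m

/-- A set which is closed under successors inside an arc and contains its first element contains
the arc. -/
theorem arc_subset_of_start_mem {D : ℕ} {c : ZMod (D + 1)} {n : ℕ} {I : Finset (ZMod (D + 1))}
    (hc : c ∈ I) (hsucc : ∀ x ∈ I, x + 1 ∈ arc D c n → x + 1 ∈ I) : arc D c n ⊆ I := by
  have key : ∀ u, u < n → c + (u : ZMod (D + 1)) ∈ I := by
    intro u
    induction u with
    | zero => intro _; simpa using hc
    | succ u ih =>
      intro hu
      have := hsucc _ (ih (by omega)) (mem_arc.2 ⟨u + 1, hu, by push_cast; ring⟩)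
      rwa [Nat.cast_succ, ← add_assoc]
  intro x hx
  obtain ⟨u, hu, rfl⟩ := mem_arc.1 hx
  exact key u hu

theorem Nonadjacent.not_isInterval_union {D : ℕ} {I J : Finset (ZMod (D + 1))}
    (h : Nonadjacent D I J) (hI : I.Nonempty) (hJ : J.Nonempty) : ¬ IsInterval D (I ∪ J) := by
  rintro ⟨c, n, h₁, -, hU⟩
  rw [← arc] at hU
  have hc : c ∈ I ∪ J := hU ▸ mem_arc.2 ⟨0, h₁, by simp⟩
  rcases Finset.mem_union.1 hc with hc | hc
  · obtain ⟨y, hy⟩ := hJ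
    have hsub := arc_subset_of_start_mem (n := n) hc (fun x hx hx' => by
      rw [← hU, Finset.mem_union] at hx'
      exact hx'.resolve_right (h.1 x hx).2)
    exact (h.1 y (hsub (hU ▸ Finset.mem_union_right _ hy))).1 hy
  · obtain ⟨y, hy⟩ := hI
    have hsub := arc_subset_of_start_mem (n := n) hc (fun x hx hx' => by
      rw [← hU, Finset.mem_union] at hx'
      exact hx'.resolve_left (h.2 x hx))
    exact (h.1 y hy).1 (hsub (hU ▸ Finset.mem_union_left _ hy))

theorem OddInterval.nonempty {D : ℕ} {I : Finset (ZMod (D + 1))} (h : OddInterval D I) :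
    I.Nonempty := Finset.card_pos.1 h.2.pos

theorem spade_iff_nonadjacent {D : ℕ} (hD : Even D) {I J : Finset (ZMod (D + 1))}
    (hI : OddInterval D I) (hJ : OddInterval D J) : Spade D I J ↔ Nonadjacent D I J := by
  constructor
  · rintro ⟨hdisj, hU⟩
    obtain ⟨a, l, hl, hlD, rfl⟩ := oddInterval_iff.1 hI
    obtain ⟨b, m, hm, hmD, rfl⟩ := oddInterval_iff.1 hJ
    have hsum : l + m ≤ D := by
      have h₁ : (arc D a l ∪ arc D b m).card = l + m := by
        rw [Finset.card_union_of_disjoint (Finset.disjoint_iff_inter_eq_empty.2 hdisj),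
          card_arc a (by omega), card_arc b (by omega)]
      have h₂ := Finset.card_le_univ (arc D a l ∪ arc D b m)
      rw [h₁, ZMod.card] at h₂
      have h₃ := hl.add_odd hm
      by_contra hlt
      have : l + m = D + 1 := by omega
      rw [this] at h₃
      exact (Nat.not_even_iff_odd.2 hD.add_one) h₃
    refine ⟨fun x hx => ⟨fun hx' => ?_, fun hx' => hU ?_⟩, fun x hx hx' => hU ?_⟩
    · have := Finset.mem_inter.2 ⟨hx, hx'⟩
      simp [hdisj] at this
    · rw [arc_union_of_succ_mem hdisj hx hx']
      exact isInterval_arc a (by have := hl.pos; omega) hsum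
    · rw [Finset.inter_comm] at hdisj
      rw [Finset.union_comm, arc_union_of_succ_mem hdisj hx hx']
      exact isInterval_arc b (by have := hl.pos; omega) (by omega)
  · intro h
    refine ⟨?_, h.not_isInterval_union hI.nonempty hJ.nonempty⟩
    rw [← Finset.disjoint_iff_inter_eq_empty, Finset.disjoint_left]
    exact fun x hx => (h.1 x hx).1

theorem arc_sdiff_eq_union {D : ℕ} (a : ZMod (D + 1)) {l s m p q p' q' : ℕ} (hl : l ≤ D)
    (hs : s + m ≤ l) (hp : p + q ≤ l) (hp' : p' + q' ≤ l)
    (h : ∀ u < l, (¬ (s ≤ u ∧ u < s + m) ↔ (p ≤ u ∧ u < p + q) ∨ (p' ≤ u ∧ u < p' + q'))) :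
    arc D a l \ arc D (a + (s : ZMod (D + 1))) m =
      arc D (a + (p : ZMod (D + 1))) q ∪ arc D (a + (p' : ZMod (D + 1))) q' := by
  ext x
  obtain ⟨u, hu, rfl⟩ := exists_eq_add D a x
  rw [Finset.mem_sdiff, Finset.mem_union, add_mem_arc a (by omega) hu,
    add_mem_arc_add a (by omega) hu, add_mem_arc_add a (by omega) hu,
    add_mem_arc_add a (by omega) hu]
  by_cases hul : u < l
  · simp only [hul, true_and]
    exact h u hul
  · omega

theorem disjoint_arc_add {D : ℕ} (a : ZMod (D + 1)) {p q p' q' : ℕ} (h : p + q ≤ p')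
    (hp' : p' + q' ≤ D + 1) :
    Disjoint (arc D (a + (p : ZMod (D + 1))) q) (arc D (a + (p' : ZMod (D + 1))) q') := by
  rw [Finset.disjoint_left]
  intro x
  obtain ⟨u, hu, rfl⟩ := exists_eq_add D a x
  rw [add_mem_arc_add a (by omega) hu, add_mem_arc_add a (by omega) hu]
  omega

theorem prec_iff_ssubset {D : ℕ} {I J : Finset (ZMod (D + 1))}
    (hI : OddInterval D I) (hJ : OddInterval D J) : Prec D J I ↔ J ⊂ I := by
  refine ⟨And.left, fun h => ⟨h, ?_⟩⟩
  obtain ⟨a, l, hl, hlD, rfl⟩ := oddInterval_iff.1 hI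
  obtain ⟨b, m, hm, hmD, rfl⟩ := oddInterval_iff.1 hJ
  have hlt := Finset.card_lt_card h
  rw [card_arc a (by omega), card_arc b (by omega)] at hlt
  obtain ⟨s, hs, rfl⟩ := exists_of_arc_subset hm.pos hlD h.1
  obtain ⟨l', rfl⟩ := hl
  obtain ⟨m', rfl⟩ := hm
  have split : ∃ p q p' q' : ℕ, 1 ≤ q ∧ 1 ≤ q' ∧ p + q ≤ p' ∧ p' + q' ≤ 2 * l' + 1 ∧
      ∀ u < 2 * l' + 1, (¬ (s ≤ u ∧ u < s + (2 * m' + 1)) ↔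
        (p ≤ u ∧ u < p + q) ∨ (p' ≤ u ∧ u < p' + q')) := by
    rcases Nat.eq_zero_or_pos s with rfl | hs0
    · exact ⟨2 * m' + 1, 1, 2 * m' + 2, 2 * l' - 2 * m' - 1, by omega, by omega, by omega,
        by omega, fun u hu => by omega⟩
    · by_cases hr : s + (2 * m' + 1) = 2 * l' + 1
      · exact ⟨0, 1, 1, s - 1, by omega, by omega, by omega, by omega, fun u hu => by omega⟩
      · exact ⟨0, s, s + (2 * m' + 1), 2 * l' - s - 2 * m', by omega, by omega, by omega,
          by omega, fun u hu => by omega⟩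
  obtain ⟨p, q, p', q', hq, hq', hpq, hpq', hcov⟩ := split
  exact ⟨_, _, isInterval_arc _ hq (by omega), isInterval_arc _ hq' (by omega),
    disjoint_arc_add a hpq (by omega), arc_sdiff_eq_union a hlD hs (by omega) hpq' hcov⟩

theorem nonadjacent_arc {D : ℕ} (a : ZMod (D + 1)) {p q p' q' : ℕ} (h : p + q < p')
    (hp' : p' + q' ≤ D) :
    Nonadjacent D (arc D (a + (p : ZMod (D + 1))) q) (arc D (a + (p' : ZMod (D + 1))) q') := by
  have succ : ∀ u : ℕ, a + (u : ZMod (D + 1)) + 1 = a + ((u + 1 : ℕ) : ZMod (D + 1)) := by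
    intro u; push_cast; ring
  refine ⟨fun x hx => ?_, fun x hx => ?_⟩ <;> obtain ⟨u, hu, rfl⟩ := exists_eq_add D a x <;>
    rw [add_mem_arc_add a (by omega) hu] at hx <;> rw [succ]
  · rw [add_mem_arc_add a (by omega) hu, add_mem_arc_add a (by omega) (by omega)]
    omega
  · rw [add_mem_arc_add a (by omega) (by omega)]
    omega

theorem arc_erase {D : ℕ} (a : ZMod (D + 1)) {l t : ℕ} (ht : t < l) (hl : l ≤ D) :
    (arc D a l).erase (a + (t : ZMod (D + 1))) =
      arc D a t ∪ arc D (a + ((t + 1 : ℕ) : ZMod (D + 1))) (l - 1 - t) := by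
  ext x
  obtain ⟨u, hu, rfl⟩ := exists_eq_add D a x
  rw [Finset.mem_erase, Finset.mem_union, add_mem_arc a (by omega) hu,
    add_mem_arc a (by omega) hu, add_mem_arc_add a (by omega) hu, ne_eq, add_right_inj]
  have : (u : ZMod (D + 1)) = t ↔ u = t :=
    ⟨natCast_inj_of_le hu (by omega), fun h => by rw [h]⟩
  rw [this]
  omega

theorem mem_evSet {D : ℕ} {I : Finset (ZMod (D + 1))} {x : ZMod (D + 1)} :
    x ∈ evSet D I ↔ x ∈ I ∧ ∃ I' I'', OddInterval D I' ∧ OddInterval D I'' ∧ Spade D I' I'' ∧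
      I.erase x = I' ∪ I'' :=
  @Finset.mem_filter _ _ (Classical.decPred _) _ _

theorem mem_evSet_arc {D : ℕ} (hD : Even D) (a : ZMod (D + 1)) {l t : ℕ} (hl : Odd l)
    (hlD : l ≤ D) (ht : t < l) : a + (t : ZMod (D + 1)) ∈ evSet D (arc D a l) ↔ Odd t := by
  rw [mem_evSet, add_mem_arc a (by omega) (by omega), and_iff_right ht]
  constructor
  · rintro ⟨I, J, hI, hJ, hsp, hU⟩
    rw [spade_iff_nonadjacent hD hI hJ] at hsp
    obtain ⟨b, m, hm, hmD, rfl⟩ := oddInterval_iff.1 hI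
    obtain ⟨c, n, hn, hnD, rfl⟩ := oddInterval_iff.1 hJ
    have hsub₁ : arc D b m ⊆ arc D a l :=
      (Finset.subset_union_left.trans hU.ge).trans (Finset.erase_subset _ _)
    have hsub₂ : arc D c n ⊆ arc D a l :=
      (Finset.subset_union_right.trans hU.ge).trans (Finset.erase_subset _ _)
    obtain ⟨s, hs, rfl⟩ := exists_of_arc_subset hm.pos hlD hsub₁
    obtain ⟨s', hs', rfl⟩ := exists_of_arc_subset hn.pos hlD hsub₂
    have hcov : ∀ u < l, u ≠ t ↔ (s ≤ u ∧ u < s + m) ∨ (s' ≤ u ∧ u < s' + n) := by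
      intro u hu
      have h := Finset.ext_iff.1 hU (a + (u : ZMod (D + 1)))
      rw [Finset.mem_erase, Finset.mem_union, add_mem_arc a (by omega) (by omega),
        add_mem_arc_add a (by omega) (by omega), add_mem_arc_add a (by omega) (by omega),
        ne_eq, add_right_inj] at h
      rw [← h, and_iff_left hu, not_iff_not]
      exact ⟨fun h => by rw [h], natCast_inj_of_le (by omega) (by omega)⟩
    have hsep : ∀ u < l, s ≤ u → u < s + m → ¬ (s' ≤ u ∧ u < s' + n) ∧
        ¬ (s' ≤ u + 1 ∧ u + 1 < s' + n) := by
      intro u hu h₁ h₂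
      have h := hsp.1 _ ((add_mem_arc_add a (by omega) (by omega)).2 ⟨h₁, h₂⟩)
      rw [add_assoc, ← Nat.cast_succ, add_mem_arc_add a (by omega) (by omega),
        add_mem_arc_add a (by omega) (by omega)] at h
      exact h
    have hsep' : ∀ u < l, s' ≤ u → u < s' + n → ¬ (s ≤ u + 1 ∧ u + 1 < s + m) := by
      intro u hu h₁ h₂
      have h := hsp.2 _ ((add_mem_arc_add a (by omega) (by omega)).2 ⟨h₁, h₂⟩)
      rw [add_assoc, ← Nat.cast_succ, add_mem_arc_add a (by omega) (by omega)] at h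
      exact h
    have hm0 := hm.pos
    have hn0 := hn.pos
    have c0 := hcov 0 (by omega)
    have ct := hcov t ht
    have s1 := hsep (s + m - 1) (by omega) (by omega) (by omega)
    have s2 := hsep' (s' + n - 1) (by omega) (by omega) (by omega)
    rcases Nat.lt_or_ge s s' with hlt | hge
    · have c1 := hcov (s + m) (by omega)
      have : t = m := by omega
      rwa [this]
    · have c1 := hcov (s' + n) (by omega)
      have : t = n := by omega
      rwa [this]
  · intro hodd
    have ht0 := hodd.pos
    obtain ⟨l', rfl⟩ := hl
    obtain ⟨t', rfl⟩ := hodd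
    have h₁ : OddInterval D (arc D a (2 * t' + 1)) :=
      oddInterval_iff.2 ⟨_, _, ⟨t', rfl⟩, by omega, rfl⟩
    have h₂ : OddInterval D (arc D (a + ((2 * t' + 1 + 1 : ℕ) : ZMod (D + 1)))
        (2 * l' + 1 - 1 - (2 * t' + 1))) :=
      oddInterval_iff.2 ⟨_, _, ⟨l' - t' - 1, by omega⟩, by omega, rfl⟩
    refine ⟨_, _, h₁, h₂, (spade_iff_nonadjacent hD h₁ h₂).2 ?_, arc_erase a ht hlD⟩
    simpa using nonadjacent_arc a (p := 0) (q := 2 * t' + 1) (p' := 2 * t' + 1 + 1)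
      (q' := 2 * l' + 1 - 1 - (2 * t' + 1)) (by omega) (by omega)

/-- Membership in `φ(V_D)` in terms of plain inclusion and separation. -/
theorem phi_iff {D : ℕ} (hD : Even D) {B : Finset (Finset (ZMod (D + 1)))} :
    phi D B ↔ (∀ I ∈ B, OddInterval D I) ∧
      (∀ I ∈ B, ∀ J ∈ B, I = J ∨ Nonadjacent D I J ∨ I ⊂ J ∨ J ⊂ I) ∧
      (∀ I ∈ B, ∀ x ∈ evSet D I, ∃ J ∈ B, J ⊂ I ∧ x ∈ J) := by
  constructor
  · rintro ⟨hodd, hP0, hP1⟩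
    refine ⟨hodd, fun I hI J hJ => ?_, fun I hI x hx => ?_⟩
    · rw [← spade_iff_nonadjacent hD (hodd I hI) (hodd J hJ),
        ← prec_iff_ssubset (hodd J hJ) (hodd I hI), ← prec_iff_ssubset (hodd I hI) (hodd J hJ)]
      exact hP0 I hI J hJ
    · obtain ⟨S, hSB, hprec, -, hcov⟩ := hP1 I hI
      obtain ⟨J, hJ, hxJ⟩ := Finset.mem_biUnion.1 (hcov hx)
      exact ⟨J, hSB hJ, (hprec J hJ).1, hxJ⟩
  · rintro ⟨hodd, hP0, hP1⟩
    refine ⟨hodd, fun I hI J hJ => ?_, fun I hI => ?_⟩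
    · rw [spade_iff_nonadjacent hD (hodd I hI) (hodd J hJ),
        prec_iff_ssubset (hodd J hJ) (hodd I hI), prec_iff_ssubset (hodd I hI) (hodd J hJ)]
      exact hP0 I hI J hJ
    · classical
      refine ⟨{J ∈ B | Maximal (fun K => K ∈ B.filter (· ⊂ I)) J}, Finset.filter_subset _ _,
        fun J hJ => ?_, fun J hJ J' hJ' hne => ?_, fun x hx => ?_⟩
      · obtain ⟨hJB, hmax⟩ := Finset.mem_filter.1 hJ
        exact (prec_iff_ssubset (hodd I hI) (hodd J hJB)).2 (Finset.mem_filter.1 hmax.prop).2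
      · obtain ⟨hJB, hmax⟩ := Finset.mem_filter.1 hJ
        obtain ⟨hJB', hmax'⟩ := Finset.mem_filter.1 hJ'
        rcases hP0 J hJB J' hJB' with h | h | h | h
        · exact absurd h hne
        · exact Finset.disjoint_left.2 fun x hx => (h.1 x hx).1
        · exact absurd (hmax.eq_of_le hmax'.prop h.1) hne
        · exact absurd (hmax'.eq_of_le hmax.prop h.1).symm hne
      · obtain ⟨J, hJB, hJI, hxJ⟩ := hP1 I hI x hx
        obtain ⟨M, hJM, hM⟩ :=
          (B.filter (· ⊂ I)).exists_le_maximal (Finset.mem_filter.2 ⟨hJB, hJI⟩)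
        exact Finset.mem_biUnion.2
          ⟨M, Finset.mem_filter.2 ⟨(Finset.mem_filter.1 hM.prop).1, hM⟩, hJM hxJ⟩

/-- Lemma 1.3(a), second case: if `{i} ∈ B`, `g_i(B) ≥ 2` and `I₂` is the smallest
element of `B` containing `i` other than `{i}`, then there are `H, H' ∈ ℐ¹` with
`H ⊔ H' = I₂ − {i}`, `H ∉ B`, `H' ∉ B`, and `(B ∪ {H, H'}) − {{i}, I₂} ∈ φ(V_D)`. -/
theorem lemma_1_3_a_case2 (D : ℕ) (hD : 2 ≤ D) (hDev : Even D)
    (B : Finset (Finset (ZMod (D + 1)))) (hB : phi D B) (i : ZMod (D + 1))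
    (hi : {i} ∈ B) (hg : 2 ≤ gB D B i)
    (I₂ : Finset (ZMod (D + 1))) (hI₂B : I₂ ∈ B) (hiI₂ : i ∈ I₂)
    (hne : I₂ ≠ {i}) (hmin : ∀ J ∈ B, i ∈ J → J ≠ {i} → I₂ ⊆ J) :
    ∃ H H' : Finset (ZMod (D + 1)), OddInterval D H ∧ OddInterval D H' ∧
      H ∩ H' = ∅ ∧ H ∪ H' = I₂.erase i ∧ H ∉ B ∧ H' ∉ B ∧
      phi D ((B ∪ {H, H'}) \ {({i} : Finset (ZMod (D + 1))), I₂}) := by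
  classical
  have hphi := (phi_iff hDev).1 hB
  obtain ⟨hodd, hP0, hP1⟩ := hphi
  obtain ⟨a, l, hl, hlD, rfl⟩ := oddInterval_iff.1 (hodd I₂ hI₂B)
  obtain ⟨t, ht, rfl⟩ := mem_arc.1 hiI₂
  set i := a + (t : ZMod (D + 1)) with hidef
  have hadj : ∀ J ∈ B, J ≠ {i} → i ∉ J → Nonadjacent D J {i} := by
    intro J hJ hJi hiJ
    rcases hP0 J hJ {i} hi with h | h | h | h
    · exact absurd h hJi
    · exact h
    · exact absurd (Finset.ssubset_singleton_iff.1 h) (hodd J hJ).nonempty.ne_empty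
    · exact absurd (h.1 (Finset.mem_singleton_self i)) hiJ
  have hinside : ∀ J ∈ B, J ⊂ arc D a l → J ≠ {i} → i ∉ J := fun J hJ hJI hJi hiJ =>
    hJI.2 (hmin J hJ hiJ hJi)
  have hcast : ∀ u ≤ D, u ≠ t → a + (u : ZMod (D + 1)) ≠ i := fun u hu hut h =>
    hut (natCast_inj_of_le hu (by omega) (add_left_cancel h))
  have htodd : Odd t := by
    by_contra hteven
    rw [Nat.not_odd_iff_even] at hteven
    rcases Nat.eq_zero_or_pos t with rfl | ht0
    · have hl1 : l ≠ 1 := by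
        rintro rfl
        exact hne (by simp [arc, hidef])
      obtain ⟨J, hJB, hJI, hxJ⟩ := hP1 _ hI₂B _
        ((mem_evSet_arc hDev a hl hlD (by omega : 1 < l)).2 odd_one)
      have hJi : J ≠ {i} := by
        rintro rfl
        exact hcast 1 (by omega) (by omega) (Finset.mem_singleton.1 hxJ)
      refine (hadj J hJB hJi (hinside J hJB hJI hJi)).2 i (Finset.mem_singleton_self i) ?_
      simpa [hidef] using hxJ
    · obtain ⟨J, hJB, hJI, hxJ⟩ := hP1 _ hI₂B _
        ((mem_evSet_arc hDev a hl hlD (by omega : t - 1 < l)).2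
          (Nat.Even.sub_odd ht0 hteven odd_one))
      have hJi : J ≠ {i} := by
        rintro rfl
        exact hcast (t - 1) (by omega) (by omega) (Finset.mem_singleton.1 hxJ)
      refine ((hadj J hJB hJi (hinside J hJB hJI hJi)).1 _ hxJ).2 (Finset.mem_singleton.2 ?_)
      rw [hidef, Nat.cast_sub ht0]
      push_cast
      ring
  have ht0 := htodd.pos
  have htl : t + 1 < l := by
    rcases hl with ⟨l', rfl⟩
    rcases htodd with ⟨t', rfl⟩
    omega
  have herase := arc_erase a ht hlD
  have hHH := nonadjacent_arc a (p := 0) (q := t) (p' := t + 1) (q' := l - 1 - t)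
    (by omega) (by omega)
  have hmemH : ∀ u ≤ D, a + (u : ZMod (D + 1)) ∈ arc D a t ↔ u < t := fun u hu =>
    add_mem_arc a (by omega) hu
  have hmemH' : ∀ u ≤ D, a + (u : ZMod (D + 1)) ∈
      arc D (a + ((t + 1 : ℕ) : ZMod (D + 1))) (l - 1 - t) ↔ t + 1 ≤ u ∧ u < l := fun u hu => by
    rw [add_mem_arc_add a (by omega) hu]
    omega
  have hH : OddInterval D (arc D a t) := oddInterval_iff.2 ⟨_, _, htodd, by omega, rfl⟩
  have hH' : OddInterval D (arc D (a + ((t + 1 : ℕ) : ZMod (D + 1))) (l - 1 - t)) := by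
    refine oddInterval_iff.2 ⟨_, _, ?_, by omega, rfl⟩
    rcases hl with ⟨l', rfl⟩
    rcases htodd with ⟨t', rfl⟩
    exact ⟨l' - t' - 1, by omega⟩
  have hevH : ∀ x ∈ evSet D (arc D a t), x ∈ evSet D (arc D a l) := by
    intro x hx
    obtain ⟨u, hu, rfl⟩ := mem_arc.1 (mem_evSet.1 hx).1
    rw [mem_evSet_arc hDev a htodd (by omega) hu] at hx
    exact (mem_evSet_arc hDev a hl hlD (by omega)).2 hx
  have hevH' : ∀ x ∈ evSet D (arc D (a + ((t + 1 : ℕ) : ZMod (D + 1))) (l - 1 - t)),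
      x ∈ evSet D (arc D a l) := by
    intro x hx
    obtain ⟨u, hu, rfl⟩ := mem_arc.1 (mem_evSet.1 hx).1
    have hlen : Odd (l - 1 - t) := by
      have := hH'.2
      rwa [card_arc _ (by omega)] at this
    rw [mem_evSet_arc hDev _ hlen (by omega) hu] at hx
    rw [add_assoc, ← Nat.cast_add]
    exact (mem_evSet_arc hDev a hl hlD (by omega)).2 (htodd.add_one.add_odd hx)
  have hlast : i ∉ arc D a t ∧ a + ((t - 1 : ℕ) : ZMod (D + 1)) ∈ arc D a t := by
    rw [hmemH _ (by omega), hmemH _ (by omega)]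
    omega
  have hfirst : i ∉ arc D (a + ((t + 1 : ℕ) : ZMod (D + 1))) (l - 1 - t) ∧
      i + 1 ∈ arc D (a + ((t + 1 : ℕ) : ZMod (D + 1))) (l - 1 - t) := by
    have : i + 1 = a + ((t + 1 : ℕ) : ZMod (D + 1)) := by rw [hidef]; push_cast; ring
    rw [this, hmemH' _ (by omega), hmemH' _ (by omega)]
    omega
  have hdisj := ((spade_iff_nonadjacent hDev hH hH').2 (by simpa using hHH)).1
  simp only [Nat.cast_zero, add_zero] at hHH
  generalize arc D a t = H at *
  generalize arc D (a + ((t + 1 : ℕ) : ZMod (D + 1))) (l - 1 - t) = H' at *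
  have hHne : H ≠ {i} := fun h => hlast.1 (h ▸ Finset.mem_singleton_self i)
  have hHne' : H' ≠ {i} := fun h => hfirst.1 (h ▸ Finset.mem_singleton_self i)
  have hHI : H ⊆ arc D a l :=
    (Finset.subset_union_left.trans herase.ge).trans (Finset.erase_subset _ _)
  have hHI' : H' ⊆ arc D a l :=
    (Finset.subset_union_right.trans herase.ge).trans (Finset.erase_subset _ _)
  have hHneI : H ≠ arc D a l := fun h => hlast.1 (h ▸ hiI₂)
  have hHneI' : H' ≠ arc D a l := fun h => hfirst.1 (h ▸ hiI₂)
  have hHB : H ∉ B := fun h => by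
    refine ((hadj H h hHne hlast.1).1 _ hlast.2).2 (Finset.mem_singleton.2 ?_)
    rw [hidef, Nat.cast_sub ht0]
    push_cast
    ring
  have hHB' : H' ∉ B := fun h =>
    (hadj H' h hHne' hfirst.1).2 i (Finset.mem_singleton_self i) hfirst.2
  have hcases : ∀ J ∈ B, J ⊂ arc D a l → J ≠ {i} → J ⊂ H ∨ J ⊂ H' := by
    intro J hJ hJI hJi
    have hiJ := hinside J hJ hJI hJi
    have hsub : J ⊆ H ∪ H' := herase ▸ Finset.subset_erase.2 ⟨hJI.1, hiJ⟩
    obtain ⟨b, m, hm, hmD, rfl⟩ := oddInterval_iff.1 (hodd J hJ)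
    have hb : b ∈ arc D b m := mem_arc.2 ⟨0, hm.pos, by simp⟩
    rcases Finset.mem_union.1 (hsub hb) with h | h
    · refine Or.inl (Finset.ssubset_iff_subset_ne.2 ⟨arc_subset_of_start_mem h fun x hx hx' => ?_,
        fun h => hHB (h ▸ hJ)⟩)
      exact (Finset.mem_union.1 (hsub hx')).resolve_right (hHH.1 x hx).2
    · refine Or.inr (Finset.ssubset_iff_subset_ne.2 ⟨arc_subset_of_start_mem h fun x hx hx' => ?_,
        fun h => hHB' (h ▸ hJ)⟩)
      exact (Finset.mem_union.1 (hsub hx')).resolve_left (hHH.2 x hx)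
  have habove : ∀ K ∈ B, arc D a l ⊂ K → i ∈ evSet D K →
      ∃ J ∈ B, arc D a l ⊂ J ∧ J ⊂ K ∧ i ∈ J := by
    intro K hK hIK hiK
    have hgrow : ∀ J ∈ B, ∀ x ∈ J, x ∉ arc D a l → ¬ Nonadjacent D J (arc D a l) →
        arc D a l ⊂ J := by
      intro J hJ x hxJ hxI hnon
      rcases hP0 J hJ _ hI₂B with h | h | h | h
      · exact absurd (h ▸ hxJ) hxI
      · exact absurd h hnon
      · exact absurd (h.1 hxJ) hxI
      · exact h
    obtain ⟨c, n, hn, hnD, rfl⟩ := oddInterval_iff.1 (hodd K hK)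
    obtain ⟨s, hs, rfl⟩ := exists_of_arc_subset hl.pos hnD hIK.1
    have hln := Finset.card_lt_card hIK
    rw [card_arc _ (by omega), card_arc _ (by omega)] at hln
    rw [hidef, add_assoc, ← Nat.cast_add, mem_evSet_arc hDev c hn hnD (by omega)] at hiK
    have hseven : Even s := by
      by_contra h
      exact Nat.not_even_iff_odd.2 hiK ((Nat.not_even_iff_odd.1 h).add_odd htodd)
    rcases Nat.eq_zero_or_pos s with rfl | hs0
    · simp only [Nat.cast_zero, add_zero] at *
      obtain ⟨J, hJB, hJK, hxJ⟩ := hP1 _ hK _ ((mem_evSet_arc hDev c hn hnD hln).2 hl)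
      have hIJ := hgrow J hJB _ hxJ (by rw [add_mem_arc c (by omega) (by omega)]; omega)
        (fun h => h.2 (c + ((l - 1 : ℕ) : ZMod (D + 1)))
          ((add_mem_arc c (by omega) (by omega)).2 (by omega)) (by
            rwa [add_assoc, ← Nat.cast_succ, Nat.succ_eq_add_one, Nat.sub_add_cancel hl.pos]))
      exact ⟨J, hJB, hIJ, hJK, hIJ.1 hiI₂⟩
    · obtain ⟨J, hJB, hJK, hxJ⟩ := hP1 _ hK _
        ((mem_evSet_arc hDev c hn hnD (by omega : s - 1 < n)).2
          (Nat.Even.sub_odd hs0 hseven odd_one))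
      have hIJ := hgrow J hJB _ hxJ (by rw [add_mem_arc_add c (by omega) (by omega)]; omega)
        (fun h => (h.1 _ hxJ).2 (by
          rw [add_assoc, ← Nat.cast_succ, Nat.succ_eq_add_one, Nat.sub_add_cancel hs0,
            add_mem_arc_add c (by omega) (by omega)]
          omega))
      exact ⟨J, hJB, hIJ, hJK, hIJ.1 hiI₂⟩
  have hmem : ∀ K, K ∈ (B ∪ {H, H'}) \ {({i} : Finset (ZMod (D + 1))), arc D a l} ↔
      (K ∈ B ∧ K ≠ {i} ∧ K ≠ arc D a l) ∨ K = H ∨ K = H' := by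
    intro K
    simp only [Finset.mem_sdiff, Finset.mem_union, Finset.mem_insert, Finset.mem_singleton]
    constructor
    · tauto
    · rintro (h | rfl | rfl) <;> tauto
  have hrel : ∀ J ∈ B, J ≠ {i} → J ≠ arc D a l →
      (Nonadjacent D J H ∨ H ⊂ J ∨ J ⊂ H) ∧ (Nonadjacent D J H' ∨ H' ⊂ J ∨ J ⊂ H') := by
    intro J hJ hJi hJI
    rcases hP0 J hJ _ hI₂B with h | h | h | h
    · exact absurd h hJI
    · exact ⟨Or.inl (h.mono subset_rfl hHI), Or.inl (h.mono subset_rfl hHI')⟩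
    · rcases hcases J hJ h hJi with h | h
      · exact ⟨Or.inr (Or.inr h), Or.inl (hHH.mono h.1 subset_rfl)⟩
      · exact ⟨Or.inl (hHH.symm.mono h.1 subset_rfl), Or.inr (Or.inr h)⟩
    · exact ⟨Or.inr (Or.inl (hHI.trans_ssubset h)), Or.inr (Or.inl (hHI'.trans_ssubset h))⟩
  have hcover : ∀ x ∈ evSet D (arc D a l), x ≠ i → ∃ J ∈ B, J ≠ {i} ∧ J ≠ arc D a l ∧
      x ∈ J ∧ (J ⊂ H ∨ J ⊂ H') := by
    intro x hx hxi
    obtain ⟨J, hJB, hJI, hxJ⟩ := hP1 _ hI₂B x hx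
    have hJi : J ≠ {i} := by
      rintro rfl
      exact hxi (Finset.mem_singleton.1 hxJ)
    exact ⟨J, hJB, hJi, hJI.ne, hxJ, hcases J hJB hJI hJi⟩
  refine ⟨H, H', hH, hH', hdisj, herase.symm, hHB, hHB', (phi_iff hDev).2 ⟨?_, ?_, ?_⟩⟩
  · intro K hK
    rcases (hmem K).1 hK with ⟨h, -⟩ | rfl | rfl
    exacts [hodd K h, hH, hH']
  · intro K hK L hL
    rcases (hmem K).1 hK with ⟨hKB, hKi, hKI⟩ | rfl | rfl <;>
      rcases (hmem L).1 hL with ⟨hLB, hLi, hLI⟩ | rfl | rfl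
    · exact hP0 K hKB L hLB
    · have := (hrel K hKB hKi hKI).1
      tauto
    · have := (hrel K hKB hKi hKI).2
      tauto
    · rcases (hrel L hLB hLi hLI).1 with h | h | h
      exacts [Or.inr (Or.inl h.symm), Or.inr (Or.inr (Or.inl h)), Or.inr (Or.inr (Or.inr h))]
    · exact Or.inl rfl
    · exact Or.inr (Or.inl hHH)
    · rcases (hrel L hLB hLi hLI).2 with h | h | h
      exacts [Or.inr (Or.inl h.symm), Or.inr (Or.inr (Or.inl h)), Or.inr (Or.inr (Or.inr h))]
    · exact Or.inr (Or.inl hHH.symm)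
    · exact Or.inl rfl
  · intro K hK x hx
    have hxK := (mem_evSet.1 hx).1
    rcases (hmem K).1 hK with ⟨hKB, hKi, hKI⟩ | rfl | rfl
    · obtain ⟨J, hJB, hJK, hxJ⟩ := hP1 K hKB x hx
      by_cases hxi : x = i
      · subst hxi
        have hIK := Finset.ssubset_iff_subset_ne.2 ⟨hmin K hKB hxK hKi, hKI.symm⟩
        obtain ⟨L, hLB, hIL, hLK, hiL⟩ := habove K hKB hIK hx
        refine ⟨L, (hmem L).2 (Or.inl ⟨hLB, ?_, hIL.ne'⟩), hLK, hiL⟩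
        rintro rfl
        exact (Finset.ssubset_singleton_iff.1 hIL ▸ Finset.notMem_empty i) hiI₂
      · by_cases hJI : J = arc D a l
        · subst hJI
          have : x ∈ H ∪ H' := herase ▸ Finset.mem_erase.2 ⟨hxi, hxJ⟩
          rcases Finset.mem_union.1 this with h | h
          · exact ⟨H, (hmem H).2 (Or.inr (Or.inl rfl)), hHI.trans_ssubset hJK, h⟩
          · exact ⟨H', (hmem H').2 (Or.inr (Or.inr rfl)), hHI'.trans_ssubset hJK, h⟩
        · refine ⟨J, (hmem J).2 (Or.inl ⟨hJB, ?_, hJI⟩), hJK, hxJ⟩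
          rintro rfl
          exact hxi (Finset.mem_singleton.1 hxJ)
    · obtain ⟨J, hJB, hJi, hJI, hxJ, h | h⟩ := hcover x (hevH x hx)
        (fun h => hlast.1 (h ▸ hxK))
      · exact ⟨J, (hmem J).2 (Or.inl ⟨hJB, hJi, hJI⟩), h, hxJ⟩
      · exact absurd (h.1 hxJ) (hHH.1 x hxK).1
    · obtain ⟨J, hJB, hJi, hJI, hxJ, h | h⟩ := hcover x (hevH' x hx)
        (fun h => hfirst.1 (h ▸ hxK))
      · exact absurd hxK (hHH.1 x (h.1 hxJ)).1
      · exact ⟨J, (hmem J).2 (Or.inl ⟨hJB, hJi, hJI⟩), h, hxJ⟩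
end

section
/- Properties of τ_j (2.1): Let D ≥ 4 be even and j ∈ {1, …, D+1}. Then τ_j : V_{D−2} → V_D is injective, satisfies (τ_j x', τ_j y')_{V_D} = (x', y')_{V_{D−2}} for all x', y' ∈ V_{D−2}, and its image satisfies: e_j ∉ image(τ_j) and image(τ_j) + F₂·e_j = {x ∈ V_D : (x, e_j) = 0}. -/
open scoped BigOperators

/-- A sum over `ZMod (n + 1)` can be evaluated by starting at any point and moving along the
cycle. -/
lemma sum_zmod_eq_sum_range {M : Type*} [AddCommMonoid M] (n : ℕ) (a : ZMod (n + 1))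
    (f : ZMod (n + 1) → M) :
    ∑ i, f i = ∑ k ∈ Finset.range (n + 1), f (a + (k : ZMod (n + 1))) := by
  rw [← Equiv.sum_comp (Equiv.addLeft a) f]
  refine Finset.sum_nbij' (fun i => i.val) (fun k => (k : ZMod (n + 1))) ?_ ?_ ?_ ?_ ?_
  · intro i _
    exact Finset.mem_range.2 (ZMod.val_lt i)
  · intro k _
    exact Finset.mem_univ _
  · intro i _
    exact ZMod.natCast_zmod_val i
  · intro k hk
    exact ZMod.val_cast_of_lt (Finset.mem_range.1 hk)
  · intro i _
    simp

lemma mk_eq_mk_iff_exists_const (D : ℕ) (x y : Wsp D) :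
    (Submodule.Quotient.mk x : Vsp D) = Submodule.Quotient.mk y ↔
      ∃ c : ZMod 2, ∀ i, x i = y i + c := by
  rw [Submodule.Quotient.eq, Submodule.mem_span_singleton]
  constructor
  · rintro ⟨c, hc⟩
    refine ⟨c, fun i => ?_⟩
    have := congrFun hc i
    simp only [allOnes, Pi.smul_apply, Pi.sub_apply, smul_eq_mul, mul_one] at this
    rw [this]
    ring
  · rintro ⟨c, hc⟩
    refine ⟨c, funext fun i => ?_⟩
    simp [allOnes, hc i]

lemma mk_out_eq (D : ℕ) (x : Vsp D) :
    (Submodule.Quotient.mk (Quotient.out x) : Vsp D) = x :=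
  Quotient.out_eq x

lemma formW_comm (D : ℕ) (x y : Wsp D) : formW D x y = formW D y x :=
  Finset.sum_congr rfl fun i _ => by ring

lemma formW_add_const_left (D : ℕ) (x y : Wsp D) (c : ZMod 2) :
    formW D (fun i => x i + c) y = formW D x y := by
  have hshift : ∑ i : ZMod (D + 1), y (i + 1) = ∑ i, y i :=
    Equiv.sum_comp (Equiv.addRight (1 : ZMod (D + 1))) y
  have hexpand : formW D (fun i => x i + c) y =
      formW D x y + c * (∑ i : ZMod (D + 1), y (i + 1) + ∑ i, y i) := by
    simp only [formW]
    rw [← Finset.sum_add_distrib, Finset.mul_sum, ← Finset.sum_add_distrib]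
    exact Finset.sum_congr rfl fun i _ => by ring
  rw [hexpand, hshift, CharTwo.add_self_eq_zero, mul_zero, add_zero]

lemma formV_mk (D : ℕ) (x y : Wsp D) :
    formV D (Submodule.Quotient.mk x) (Submodule.Quotient.mk y) = formW D x y := by
  obtain ⟨c, hc⟩ := (mk_eq_mk_iff_exists_const D _ x).1 (mk_out_eq D (Submodule.Quotient.mk x))
  obtain ⟨d, hd⟩ := (mk_eq_mk_iff_exists_const D _ y).1 (mk_out_eq D (Submodule.Quotient.mk y))
  rw [formV, funext hc, funext hd, formW_add_const_left, formW_comm, formW_add_const_left,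
    formW_comm]

lemma formW_single_right (D : ℕ) (x : Wsp D) (j : ZMod (D + 1)) :
    formW D x (Pi.single j 1) = x (j - 1) + x (j + 1) := by
  simp only [formW, Pi.single_apply, Finset.sum_add_distrib, mul_ite, mul_one, mul_zero,
    ← eq_sub_iff_add_eq, Finset.sum_ite_eq', Finset.mem_univ, if_true]

lemma mk_eq_sum_smul_eV (D : ℕ) (x : Wsp D) :
    (Submodule.Quotient.mk x : Vsp D) = ∑ i, x i • eV D i := by
  have hx : x = ∑ i, x i • (Pi.single i 1 : Wsp D) := by
    ext k
    simp [Pi.single_apply]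
  conv_lhs => rw [hx]
  exact map_sum (Submodule.mkQ (Submodule.span (ZMod 2) {allOnes D})) _ _

/-- The cyclic map collapsing `j - 1`, `j`, `j + 1` to `j - 1`; pulling back functions along it
induces `tauMap D j`. -/
def collapse (D j : ℕ) (s : ZMod (D + 1)) : ZMod (D - 2 + 1) :=
  if (s - ((j : ZMod (D + 1)) + 1)).val = D then ((j - 1 : ℕ) : ZMod (D - 2 + 1))
  else ((j - 1 : ℕ) : ZMod (D - 2 + 1)) + ((s - ((j : ZMod (D + 1)) + 1)).val : ZMod (D - 2 + 1))

lemma collapse_add (D j k : ℕ) (hk : k < D) :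
    collapse D j ((j : ZMod (D + 1)) + 1 + (k : ZMod (D + 1))) =
      ((j - 1 : ℕ) : ZMod (D - 2 + 1)) + (k : ZMod (D - 2 + 1)) := by
  have hval : ((k : ZMod (D + 1))).val = k := ZMod.val_cast_of_lt (by omega)
  rw [collapse, add_sub_cancel_left, hval, if_neg hk.ne]

lemma add_one_add_natCast_self (D : ℕ) (a : ZMod (D + 1)) : a + 1 + (D : ZMod (D + 1)) = a := by
  have h : (D : ZMod (D + 1)) + 1 = 0 := by exact_mod_cast ZMod.natCast_self (D + 1)
  linear_combination h

lemma add_one_add_natCast_pred (D : ℕ) (hD : 1 ≤ D) (a : ZMod (D + 1)) :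
    a + 1 + ((D - 1 : ℕ) : ZMod (D + 1)) = a - 1 := by
  have h : (D : ZMod (D + 1)) + 1 = 0 := by exact_mod_cast ZMod.natCast_self (D + 1)
  rw [Nat.cast_sub hD, Nat.cast_one]
  linear_combination h

lemma collapse_self (D j : ℕ) :
    collapse D j (j : ZMod (D + 1)) = ((j - 1 : ℕ) : ZMod (D - 2 + 1)) := by
  have hval : ((D : ZMod (D + 1))).val = D := ZMod.val_cast_of_lt (by omega)
  conv_lhs => rw [← add_one_add_natCast_self D (j : ZMod (D + 1))]
  rw [collapse, add_sub_cancel_left, hval, if_pos rfl]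

lemma collapse_add_one (D j : ℕ) (hD : 0 < D) :
    collapse D j ((j : ZMod (D + 1)) + 1) = ((j - 1 : ℕ) : ZMod (D - 2 + 1)) := by
  simpa using collapse_add D j 0 hD

lemma natCast_pred_eq_zero (D : ℕ) (hD : 2 ≤ D) : ((D - 1 : ℕ) : ZMod (D - 2 + 1)) = 0 := by
  rw [show D - 1 = D - 2 + 1 by omega]
  exact ZMod.natCast_self _

lemma collapse_sub_one (D j : ℕ) (hD : 2 ≤ D) :
    collapse D j ((j : ZMod (D + 1)) - 1) = ((j - 1 : ℕ) : ZMod (D - 2 + 1)) := by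
  rw [← add_one_add_natCast_pred D (by omega), collapse_add D j _ (by omega),
    natCast_pred_eq_zero D hD, add_zero]

lemma exists_eq_add_natCast (n : ℕ) (a s : ZMod (n + 1)) :
    ∃ k : ℕ, k < n + 1 ∧ s = a + (k : ZMod (n + 1)) :=
  ⟨(s - a).val, ZMod.val_lt _, by simp⟩

lemma collapse_surjective (D j : ℕ) (hD : 2 ≤ D) : Function.Surjective (collapse D j) := by
  intro i
  obtain ⟨k, hk, rfl⟩ := exists_eq_add_natCast _ ((j - 1 : ℕ) : ZMod (D - 2 + 1)) i
  exact ⟨_, collapse_add D j k (by omega)⟩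

lemma tauTgt_center (D j : ℕ) :
    tauTgt D j ((j - 1 : ℕ) : ZMod (D - 2 + 1)) =
      eV D ((j : ZMod (D + 1)) - 1) + eV D (j : ZMod (D + 1)) +
        eV D ((j : ZMod (D + 1)) + 1) := by
  simp [tauTgt]

lemma natCast_eq_of_eq_add (D a b : ℕ) (h : b = a + (D + 1)) :
    (a : ZMod (D + 1)) = (b : ZMod (D + 1)) := by
  rw [h, Nat.cast_add, ZMod.natCast_self, add_zero]

lemma tauTgt_add (D j k : ℕ) (hD : 2 ≤ D) (hj1 : 1 ≤ j) (hj2 : j ≤ D + 1) (hk1 : 1 ≤ k)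
    (hk2 : k < D - 1) :
    tauTgt D j (((j - 1 : ℕ) : ZMod (D - 2 + 1)) + (k : ZMod (D - 2 + 1))) =
      eV D ((j : ZMod (D + 1)) + 1 + (k : ZMod (D + 1))) := by
  have hne : ((j - 1 : ℕ) : ZMod (D - 2 + 1)) + (k : ZMod (D - 2 + 1)) ≠
      ((j - 1 : ℕ) : ZMod (D - 2 + 1)) := by
    intro h
    rw [add_eq_left, ZMod.natCast_eq_zero_iff] at h
    have := Nat.le_of_dvd hk1 h
    omega
  have hval : (((j - 1 : ℕ) : ZMod (D - 2 + 1)) + (k : ZMod (D - 2 + 1))).val =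
      (j - 1 + k) % (D - 1) := by
    rw [← Nat.cast_add, ZMod.val_natCast, show D - 2 + 1 = D - 1 by omega]
  have hcast : (j : ZMod (D + 1)) + 1 + (k : ZMod (D + 1)) = ((j + 1 + k : ℕ) : ZMod (D + 1)) := by
    push_cast
    rfl
  simp only [tauTgt]
  rw [if_neg hne, hval, hcast]
  rcases lt_trichotomy (j - 1 + k) (D - 1) with h | h | h
  · have h0 : j - 1 + k ≠ 0 := by omega
    rw [Nat.mod_eq_of_lt h, if_neg h0, if_neg (by omega)]
    congr 2
    omega
  · rw [h, Nat.mod_self, if_pos rfl, if_neg (by omega)]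
    congr 2
    omega
  · rcases (show j - 1 + k < 2 * (D - 1) ∨ j - 1 + k = 2 * (D - 1) by omega) with h' | h'
    · have h0 : j - 1 + k - (D - 1) ≠ 0 := by omega
      rw [Nat.mod_eq_sub_mod h.le, Nat.mod_eq_of_lt (by omega), if_neg h0, if_pos (by omega)]
      exact congrArg _ (natCast_eq_of_eq_add D _ _ (by omega))
    · rw [h', Nat.mul_mod_left, if_pos rfl, if_pos (by omega)]
      exact congrArg _ (natCast_eq_of_eq_add D _ _ (by omega))

lemma range_add_one_split {M : Type*} [AddCommMonoid M] (D : ℕ) (hD : 2 ≤ D) (f : ℕ → M) :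
    ∑ k ∈ Finset.range (D + 1), f k =
      ∑ k ∈ Finset.range (D - 2 + 1), f k + f (D - 1) + f D := by
  obtain ⟨n, rfl⟩ := Nat.exists_eq_add_of_le' hD
  rw [Finset.sum_range_succ, Finset.sum_range_succ]
  rfl

lemma sum_smul_tauTgt (D j : ℕ) (hD : 2 ≤ D) (hj1 : 1 ≤ j) (hj2 : j ≤ D + 1)
    (w : Wsp (D - 2)) :
    ∑ i, w i • tauTgt D j i = Submodule.Quotient.mk (w ∘ collapse D j) := by
  rw [mk_eq_sum_smul_eV, sum_zmod_eq_sum_range _ ((j - 1 : ℕ) : ZMod (D - 2 + 1)),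
    sum_zmod_eq_sum_range _ ((j : ZMod (D + 1)) + 1), range_add_one_split D hD,
    Finset.sum_range_succ', Finset.sum_range_succ']
  have hterm : ∀ k ∈ Finset.range (D - 2),
      w (((j - 1 : ℕ) : ZMod (D - 2 + 1)) + ((k + 1 : ℕ) : ZMod (D - 2 + 1))) •
        tauTgt D j (((j - 1 : ℕ) : ZMod (D - 2 + 1)) + ((k + 1 : ℕ) : ZMod (D - 2 + 1))) =
      (w ∘ collapse D j) ((j : ZMod (D + 1)) + 1 + ((k + 1 : ℕ) : ZMod (D + 1))) •
        eV D ((j : ZMod (D + 1)) + 1 + ((k + 1 : ℕ) : ZMod (D + 1))) := by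
    intro k hk
    have hk' := Finset.mem_range.1 hk
    rw [tauTgt_add D j _ hD hj1 hj2 (by omega) (by omega), Function.comp_apply,
      collapse_add D j _ (by omega)]
  rw [Finset.sum_congr rfl hterm, add_one_add_natCast_self, add_one_add_natCast_pred D (by omega)]
  simp only [Nat.cast_zero, add_zero, Function.comp_apply, collapse_self,
    collapse_add_one D j (by omega), collapse_sub_one D j hD, tauTgt_center, smul_add]
  abel

lemma tauMap_mk (D j : ℕ) (hD : 2 ≤ D) (hj1 : 1 ≤ j) (hj2 : j ≤ D + 1) (w : Wsp (D - 2)) :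
    tauMap D j (Submodule.Quotient.mk w) = Submodule.Quotient.mk (w ∘ collapse D j) := by
  obtain ⟨c, hc⟩ := (mk_eq_mk_iff_exists_const _ _ w).1 (mk_out_eq _ (Submodule.Quotient.mk w))
  rw [tauMap, sum_smul_tauTgt D j hD hj1 hj2, mk_eq_mk_iff_exists_const]
  exact ⟨c, fun i => hc _⟩

lemma formW_comp_collapse (D j : ℕ) (hD : 2 ≤ D) (x y : Wsp (D - 2)) :
    formW D (x ∘ collapse D j) (y ∘ collapse D j) = formW (D - 2) x y := by
  simp only [formW]
  rw [sum_zmod_eq_sum_range _ ((j : ZMod (D + 1)) + 1), range_add_one_split D hD,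
    sum_zmod_eq_sum_range _ ((j - 1 : ℕ) : ZMod (D - 2 + 1)),
    add_one_add_natCast_self, add_one_add_natCast_pred D (by omega), sub_add_cancel]
  simp only [Function.comp_apply, collapse_self, collapse_add_one D j (by omega),
    collapse_sub_one D j hD]
  rw [CharTwo.add_self_eq_zero, add_zero, add_zero]
  refine Finset.sum_congr rfl fun k hk => ?_
  have hk' := Finset.mem_range.1 hk
  have hs : collapse D j ((j : ZMod (D + 1)) + 1 + (k : ZMod (D + 1)) + 1) =
      ((j - 1 : ℕ) : ZMod (D - 2 + 1)) + (k : ZMod (D - 2 + 1)) + 1 := by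
    have := collapse_add D j (k + 1) (by omega)
    push_cast at this
    rw [add_assoc _ (k : ZMod (D + 1)) 1, this, add_assoc]
  rw [hs, collapse_add D j k (by omega)]

/-- A function with equal values at `j - 1` and `j + 1` is, away from `j`, a pullback along
`collapse D j`. -/
lemma exists_comp_collapse_eq (D j : ℕ) (hD : 2 ≤ D) (z : Wsp D)
    (hz : z ((j : ZMod (D + 1)) - 1) = z ((j : ZMod (D + 1)) + 1)) :
    ∃ w : Wsp (D - 2), ∀ s, s ≠ (j : ZMod (D + 1)) → w (collapse D j s) = z s := by
  refine ⟨fun i => z ((j : ZMod (D + 1)) + 1 +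
    ((i - ((j - 1 : ℕ) : ZMod (D - 2 + 1))).val : ZMod (D + 1))), fun s hs => ?_⟩
  obtain ⟨k, hk, rfl⟩ := exists_eq_add_natCast D ((j : ZMod (D + 1)) + 1) s
  have hkD : k ≠ D := by
    rintro rfl
    exact hs (add_one_add_natCast_self _ _)
  rw [collapse_add D j k (by omega)]
  simp only [add_sub_cancel_left]
  by_cases h : k = D - 1
  · rw [h, natCast_pred_eq_zero D hD, add_one_add_natCast_pred D (by omega), hz]
    simp
  · rw [ZMod.val_cast_of_lt (by omega)]

/-- Properties of `τ_j` (2.1): it is injective, compatible with the symplectic forms,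
`e_j` is not in its image, and `image(τ_j) + F₂·e_j = {x : (x, e_j) = 0}`. -/
theorem tau_properties (D : ℕ) (hD : 4 ≤ D) (hDev : Even D)
    (j : ℕ) (hj1 : 1 ≤ j) (hj2 : j ≤ D + 1) :
    Function.Injective (tauMap D j) ∧
    (∀ x' y' : Vsp (D - 2),
      formV D (tauMap D j x') (tauMap D j y') = formV (D - 2) x' y') ∧
    eV D (j : ZMod (D + 1)) ∉ Set.range (tauMap D j) ∧
    {x : Vsp D | ∃ y ∈ Set.range (tauMap D j), ∃ c : ZMod 2,
        x = y + c • eV D (j : ZMod (D + 1))} =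
      {x : Vsp D | formV D x (eV D (j : ZMod (D + 1))) = 0} := by
  have hD2 : 2 ≤ D := by omega
  have hmk := tauMap_mk D j hD2 hj1 hj2
  have : Fact (1 < D + 1) := ⟨by omega⟩
  have hnext : (j : ZMod (D + 1)) + 1 ≠ j := by simp
  have hprev : (j : ZMod (D + 1)) - 1 ≠ j := by simp
  refine ⟨?_, ?_, ?_, ?_⟩
  · intro x y hxy
    obtain ⟨x, rfl⟩ := Submodule.Quotient.mk_surjective _ x
    obtain ⟨y, rfl⟩ := Submodule.Quotient.mk_surjective _ y
    rw [hmk, hmk, mk_eq_mk_iff_exists_const] at hxy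
    obtain ⟨c, hc⟩ := hxy
    rw [mk_eq_mk_iff_exists_const]
    exact ⟨c, (collapse_surjective D j hD2).forall.2 hc⟩
  · intro x y
    obtain ⟨x, rfl⟩ := Submodule.Quotient.mk_surjective _ x
    obtain ⟨y, rfl⟩ := Submodule.Quotient.mk_surjective _ y
    rw [hmk, hmk, formV_mk, formV_mk, formW_comp_collapse D j hD2]
  · rintro ⟨x, hx⟩
    obtain ⟨x, rfl⟩ := Submodule.Quotient.mk_surjective _ x
    rw [hmk, eV, mk_eq_mk_iff_exists_const] at hx
    obtain ⟨c, hc⟩ := hx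
    have hself := hc (j : ZMod (D + 1))
    have hsucc := hc ((j : ZMod (D + 1)) + 1)
    rw [Function.comp_apply, collapse_self, Pi.single_eq_same] at hself
    rw [Function.comp_apply, collapse_add_one D j (by omega), Pi.single_eq_of_ne hnext,
      hself] at hsucc
    exact one_ne_zero (add_right_cancel hsucc)
  · ext x
    simp only [Set.mem_ofPred_eq]
    constructor
    · rintro ⟨_, ⟨y, rfl⟩, c, rfl⟩
      obtain ⟨y, rfl⟩ := Submodule.Quotient.mk_surjective _ y
      rw [hmk, eV, ← Submodule.Quotient.mk_smul, ← Submodule.Quotient.mk_add, formV_mk,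
        formW_single_right]
      simp only [Pi.add_apply, Pi.smul_apply, Pi.single_eq_of_ne hnext,
        Pi.single_eq_of_ne hprev, Function.comp_apply, collapse_add_one D j (by omega : 0 < D),
        collapse_sub_one D j hD2, CharTwo.add_self_eq_zero]
    · intro hx
      obtain ⟨z, rfl⟩ := Submodule.Quotient.mk_surjective _ x
      rw [eV, formV_mk, formW_single_right, CharTwo.add_eq_zero] at hx
      obtain ⟨w, hw⟩ := exists_comp_collapse_eq D j hD2 z hx
      refine ⟨_, ⟨Submodule.Quotient.mk w, rfl⟩,
        z (j : ZMod (D + 1)) - w (collapse D j (j : ZMod (D + 1))), ?_⟩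
      rw [hmk, eV, ← Submodule.Quotient.mk_smul, ← Submodule.Quotient.mk_add]
      congr 1
      ext s
      by_cases hs : s = (j : ZMod (D + 1))
      · simp [hs]
      · simp [hs, hw s hs]
end
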